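/- arXiv:math/0703027 — 2 statements merged into one kernel-verified Lean document; each statement's English description precedes it below -/
import Mathlib

section
/- Under Assumption 2.3 (with z_{v₀,e₀} and z_{v₁,e₀} finite), for every γ ∈ ℝ the measures Π^{γφ} and ℙ_{v₀,v₁,e₀} are mutually absolutely continuous, and for ρ_{e₀}-almost all x ∈ Ω_{e₀} the Radon–Nikodym derivative satisfies log( dΠ^{γφ}/dℙ_{v₀,v₁,e₀} )(Ξ^{γφ}(x)) = f_γ(x), where f_γ(x) := γ(a_{v₁}/2 + 1/4) − γ∑_{e∈E} φ(e)a_e + ∑_{v∈V∖{v₀,v₁}} ((a_v+1)/2)·log(x_v^{(γφ)}/x_v) − (1/2)·log( ∑_{T∈𝒯} Y_T^{(γφ)}(x) / ∑_{T∈𝒯} Y_T(x) ). -/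
open MeasureTheory
open scoped ENNReal Classical

namespace ERRWGraph

noncomputable section

variable {V : Type*} [Fintype V] [DecidableEq V]

/-- The measure `dx/x` on `(0,∞)`, i.e. Lebesgue measure on a logarithmic scale. -/
def logMeasure : Measure ℝ :=
  (volume.restrict (Set.Ioi (0 : ℝ))).withDensity fun x => ENNReal.ofReal (1 / x)

variable (G : SimpleGraph V) [Fintype G.edgeSet]

/-- The set `Ω_{e₀}` of strictly positive edge weights normalized at the reference
edge `e₀`. -/
def Omega (e₀ : G.edgeSet) : Set (G.edgeSet → ℝ) :=
  {x | (∀ e, 0 < x e) ∧ x e₀ = 1}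

/-- The reference measure `ρ_{e₀} = δ₁(dx_{e₀}) ∏_{e ≠ e₀} dx_e/x_e`, realized as a
measure on `(0,∞)^E ⊆ ℝ^E` concentrated on `Ω_{e₀}`. -/
def rho (e₀ : G.edgeSet) : Measure (G.edgeSet → ℝ) :=
  Measure.pi fun e => if e = e₀ then Measure.dirac 1 else logMeasure

/-- Vertex weight `x_v = ∑_{e ∋ v} x_e`. -/
def vwt (x : G.edgeSet → ℝ) (v : V) : ℝ :=
  ∑ e : G.edgeSet, if v ∈ (e : Sym2 V) then x e else 0

/-- Vertex weight `a_v = ∑_{e ∋ v} a_e` of the initial weights `a : Sym2 V → ℝ`. -/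
def avwt (a : Sym2 V → ℝ) (v : V) : ℝ :=
  ∑ e : G.edgeSet, if v ∈ (e : Sym2 V) then a (e : Sym2 V) else 0

/-- A set `T` of edges of `G` is a spanning tree iff the graph with edge set `T`
is a tree (i.e. a maximal connected acyclic subgraph of `G`). -/
def IsSpanningTree (T : Finset G.edgeSet) : Prop :=
  (SimpleGraph.fromEdgeSet (Subtype.val '' (T : Set G.edgeSet))).IsTree

/-- `∑_{T ∈ 𝒯} ∏_{e ∈ T} x_e`, the sum over spanning trees of `G`. -/
def treeSum (x : G.edgeSet → ℝ) : ℝ :=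
  ∑ T : Finset G.edgeSet, if IsSpanningTree G T then (∏ e ∈ T, x e) else 0

/-- The function `Φ_{v₀,a}` from the Coppersmith–Diaconis description of the
mixing measure. -/
def Phi (a : Sym2 V → ℝ) (v₀ : V) (x : G.edgeSet → ℝ) : ℝ :=
  (∏ e : G.edgeSet, x e ^ a (e : Sym2 V)) * vwt G x v₀ ^ (-avwt G a v₀ / 2) *
    (∏ v ∈ Finset.univ.erase v₀, vwt G x v ^ (-(avwt G a v + 1) / 2)) *
    Real.sqrt (treeSum G x)

/-- The normalizing constant `z_{v₀,e₀} = ∫ Φ_{v₀,a} dρ_{e₀}`. -/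
def z (a : Sym2 V → ℝ) (v₀ : V) (e₀ : G.edgeSet) : ℝ≥0∞ :=
  ∫⁻ x, ENNReal.ofReal (Phi G a v₀ x) ∂rho G e₀

/-- The mixing measure `ℚ_{v₀,e₀}`, with density `Φ_{v₀,a}/z_{v₀,e₀}` w.r.t. `ρ_{e₀}`. -/
def Qm (a : Sym2 V → ℝ) (v₀ : V) (e₀ : G.edgeSet) : Measure (G.edgeSet → ℝ) :=
  (z G a v₀ e₀)⁻¹ • (rho G e₀).withDensity fun x => ENNReal.ofReal (Phi G a v₀ x)

/-- The density `((Φ_{v₀,a}/z_{v₀,e₀})·(Φ_{v₁,a}/z_{v₁,e₀}))^{1/2}` of the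
interpolated measure. -/
def interpDens (a : Sym2 V → ℝ) (v₀ v₁ : V) (e₀ : G.edgeSet) (x : G.edgeSet → ℝ) : ℝ≥0∞ :=
  (ENNReal.ofReal (Phi G a v₀ x) / z G a v₀ e₀ *
    (ENNReal.ofReal (Phi G a v₁ x) / z G a v₁ e₀)) ^ (1 / 2 : ℝ)

/-- The normalizing constant `Z_{v₀,v₁,e₀}` of the interpolated measure. -/
def Zc (a : Sym2 V → ℝ) (v₀ v₁ : V) (e₀ : G.edgeSet) : ℝ≥0∞ :=
  ∫⁻ x, interpDens G a v₀ v₁ e₀ x ∂rho G e₀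

/-- The interpolated measure `ℙ_{v₀,v₁,e₀}`. -/
def Pm (a : Sym2 V → ℝ) (v₀ v₁ : V) (e₀ : G.edgeSet) : Measure (G.edgeSet → ℝ) :=
  (Zc G a v₀ v₁ e₀)⁻¹ • (rho G e₀).withDensity (interpDens G a v₀ v₁ e₀)

/-- `f` is an automorphism of the weighted graph `(G,a)`. -/
def IsAut (a : Sym2 V → ℝ) (f : V → V) : Prop :=
  Function.Bijective f ∧ (∀ u v : V, G.Adj (f u) (f v) ↔ G.Adj u v) ∧
    ∀ u v : V, G.Adj u v → a s(f u, f v) = a s(u, v)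

/-- Assumption 2.3 of the paper. -/
def Assumption23 (a φ : Sym2 V → ℝ) (v₀ v₁ : V) (e₀ : G.edgeSet) : Prop :=
  v₀ ≠ v₁ ∧ ¬G.Adj v₀ v₁ ∧ v₀ ∈ (e₀ : Sym2 V) ∧
    (∃ f : V → V, IsAut G a f ∧ f v₀ = v₁ ∧ f v₁ = v₀) ∧
    (∀ e : G.edgeSet, φ (e : Sym2 V) ∈ Set.Icc (0 : ℝ) 1) ∧
    (∀ e : G.edgeSet, v₀ ∈ (e : Sym2 V) → φ (e : Sym2 V) = 0) ∧
    (∀ e : G.edgeSet, v₁ ∈ (e : Sym2 V) → φ (e : Sym2 V) = 1)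

/-- `max_{e,e' ∋ v} (φ(e) - φ(e'))²`. -/
def maxsq (φ : Sym2 V → ℝ) (v : V) : ℝ :=
  sSup ((fun p : G.edgeSet × G.edgeSet =>
      (φ (p.1 : Sym2 V) - φ (p.2 : Sym2 V)) ^ 2) ''
    {p : G.edgeSet × G.edgeSet | v ∈ (p.1 : Sym2 V) ∧ v ∈ (p.2 : Sym2 V)})

/-- The "Dirichlet form" `S_φ`. -/
def Sphi (a φ : Sym2 V → ℝ) : ℝ :=
  ∑ v : V, (avwt G a v + 1) / 2 * maxsq G φ v

/-- `H_{v₀,v₁}(x) = (1/4) log (x_{v₁}/x_{v₀})`. -/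
def Hfun (v₀ v₁ : V) (x : G.edgeSet → ℝ) : ℝ :=
  (1 / 4) * Real.log (vwt G x v₁ / vwt G x v₀)

/-- `log (dQ/dP)` realized via the Radon–Nikodym derivative. -/
def logRN {α : Type*} [MeasurableSpace α] (Q P : Measure α) (x : α) : ℝ :=
  Real.log ((Q.rnDeriv P x).toReal)

/-- The deformation map `Ξ^{γφ}(x) = (e^{γφ(e)} x_e)_{e∈E}`. -/
def Xi (φ : Sym2 V → ℝ) (γ : ℝ) (x : G.edgeSet → ℝ) : G.edgeSet → ℝ :=
  fun e => Real.exp (γ * φ (e : Sym2 V)) * x e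

/-- `Π^{γφ}`, the image of `ℙ_{v₀,v₁,e₀}` under `Ξ^{γφ}`. -/
def PiGamma (a φ : Sym2 V → ℝ) (v₀ v₁ : V) (e₀ : G.edgeSet) (γ : ℝ) :
    Measure (G.edgeSet → ℝ) :=
  Measure.map (Xi G φ γ) (Pm G a v₀ v₁ e₀)

/-- The explicit realization `f_γ` of `log(dΠ^{γφ}/dℙ_{v₀,v₁,e₀}) ∘ Ξ^{γφ}`. -/
def fgamma (a φ : Sym2 V → ℝ) (v₀ v₁ : V) (γ : ℝ) (x : G.edgeSet → ℝ) : ℝ :=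
  γ * (avwt G a v₁ / 2 + 1 / 4) -
    γ * ∑ e : G.edgeSet, φ (e : Sym2 V) * a (e : Sym2 V) +
    (∑ v ∈ Finset.univ \ {v₀, v₁}, (avwt G a v + 1) / 2 *
      Real.log (vwt G (Xi G φ γ x) v / vwt G x v)) -
    (1 / 2) * Real.log (treeSum G (Xi G φ γ x) / treeSum G x)

/-- Mean of `φ` under the measure `μ_{x,v,γ}` on the edges incident to `v`. -/
def muMean (φ : Sym2 V → ℝ) (γ : ℝ) (x : G.edgeSet → ℝ) (v : V) : ℝ :=
  (∑ e : G.edgeSet, if v ∈ (e : Sym2 V) then φ (e : Sym2 V) * Xi G φ γ x e else 0) /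
    vwt G (Xi G φ γ x) v

/-- Variance of `φ` under `μ_{x,v,γ}`. -/
def muVar (φ : Sym2 V → ℝ) (γ : ℝ) (x : G.edgeSet → ℝ) (v : V) : ℝ :=
  (∑ e : G.edgeSet, if v ∈ (e : Sym2 V) then
      (φ (e : Sym2 V) - muMean G φ γ x v) ^ 2 * Xi G φ γ x e else 0) /
    vwt G (Xi G φ γ x) v

/-- `Δ(T) = ∑_{e ∈ T} φ(e)`. -/
def Delta (φ : Sym2 V → ℝ) (T : Finset G.edgeSet) : ℝ := ∑ e ∈ T, φ (e : Sym2 V)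

/-- Mean of `Δ` under the measure `ν_{x,γ}` on spanning trees. -/
def nuMean (φ : Sym2 V → ℝ) (γ : ℝ) (x : G.edgeSet → ℝ) : ℝ :=
  (∑ T : Finset G.edgeSet, if IsSpanningTree G T then
      Delta G φ T * ∏ e ∈ T, Xi G φ γ x e else 0) /
    treeSum G (Xi G φ γ x)

/-- Variance of `Δ` under `ν_{x,γ}`. -/
def nuVar (φ : Sym2 V → ℝ) (γ : ℝ) (x : G.edgeSet → ℝ) : ℝ :=
  (∑ T : Finset G.edgeSet, if IsSpanningTree G T then
      (Delta G φ T - nuMean G φ γ x) ^ 2 * ∏ e ∈ T, Xi G φ γ x e else 0) /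
    treeSum G (Xi G φ γ x)

/-- The claimed first derivative of `γ ↦ f_γ(x)`. -/
def fder1 (a φ : Sym2 V → ℝ) (v₀ v₁ : V) (x : G.edgeSet → ℝ) (γ : ℝ) : ℝ :=
  avwt G a v₁ / 2 + 1 / 4 - (∑ e : G.edgeSet, φ (e : Sym2 V) * a (e : Sym2 V)) +
    (∑ v ∈ Finset.univ \ {v₀, v₁}, (avwt G a v + 1) / 2 * muMean G φ γ x v) -
    (1 / 2) * nuMean G φ γ x

/-- The claimed second derivative of `γ ↦ f_γ(x)`. -/
def fder2 (a φ : Sym2 V → ℝ) (v₀ v₁ : V) (x : G.edgeSet → ℝ) (γ : ℝ) : ℝ :=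
  (∑ v ∈ Finset.univ \ {v₀, v₁}, (avwt G a v + 1) / 2 * muVar G φ γ x v) -
    (1 / 2) * nuVar G φ γ x

/-- Membership in the class `𝒫` of the variational principle. -/
def VarP (a : Sym2 V → ℝ) (v₀ v₁ : V) (e₀ : G.edgeSet)
    (Q : Measure (G.edgeSet → ℝ)) : Prop :=
  IsProbabilityMeasure Q ∧ Q ≪ Pm G a v₀ v₁ e₀ ∧ Pm G a v₀ v₁ e₀ ≪ Q ∧
    Integrable (Hfun G v₀ v₁) Q ∧ Integrable (logRN Q (Pm G a v₀ v₁ e₀)) Q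

/-- The functional `F(Π) = E_Π[H] + E_Π[log(dΠ/dℙ_{v₀,v₁,e₀})]`. -/
def Ffun (a : Sym2 V → ℝ) (v₀ v₁ : V) (e₀ : G.edgeSet)
    (Q : Measure (G.edgeSet → ℝ)) : ℝ :=
  (∫ x, Hfun G v₀ v₁ x ∂Q) + ∫ x, logRN Q (Pm G a v₀ v₁ e₀) x ∂Q

end

end ERRWGraph

namespace ERRWGraph

section DensityTransport

variable {α : Type*} [MeasurableSpace α] {μ : Measure α}

/-- The image of a measure with density `D` under a measure-preserving equivalence. -/
lemma map_withDensity_of_measurePreserving (T : α ≃ᵐ α) (hT : MeasurePreserving T μ μ)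
    {D : α → ℝ≥0∞} (hD : Measurable D) :
    (μ.withDensity D).map T = μ.withDensity (D ∘ T.symm) := by
  ext s hs
  rw [T.map_apply, withDensity_apply _ (T.measurable hs), withDensity_apply _ hs,
    ← hT.setLIntegral_comp_preimage hs (hD.comp T.symm.measurable)]
  simp

/-- A measure with a positive and finite density `D` and its image under a measure-preserving
equivalence `T` are equivalent, with relative density `D / (D ∘ T)` along `T`. -/
lemma rnDeriv_map_withDensity [SigmaFinite μ] (T : α ≃ᵐ α) (hT : MeasurePreserving T μ μ)
    {D : α → ℝ≥0∞} (hD : Measurable D) (h0 : ∀ᵐ x ∂μ, D x ≠ 0) (htop : ∀ᵐ x ∂μ, D x ≠ ⊤) :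
    (μ.withDensity D).map T ≪ μ.withDensity D ∧
    μ.withDensity D ≪ (μ.withDensity D).map T ∧
    ∀ᵐ x ∂μ, ((μ.withDensity D).map T).rnDeriv (μ.withDensity D) (T x) = D x / D (T x) := by
  have hDS : Measurable (D ∘ T.symm) := hD.comp T.symm.measurable
  have h0S : ∀ᵐ x ∂μ, (D ∘ T.symm) x ≠ 0 := (hT.symm T).quasiMeasurePreserving.ae h0
  have hac : μ ≪ μ.withDensity D := withDensity_absolutelyContinuous' hD.aemeasurable h0
  rw [map_withDensity_of_measurePreserving T hT hD]
  refine ⟨(withDensity_absolutelyContinuous _ _).trans hac,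
    (withDensity_absolutelyContinuous _ _).trans
      (withDensity_absolutelyContinuous' hDS.aemeasurable h0S), ?_⟩
  have hsf : SigmaFinite (μ.withDensity D) := SigmaFinite.withDensity_of_ne_top htop
  have hq : μ.withDensity (D ∘ T.symm) =
      (μ.withDensity D).withDensity (D ∘ T.symm / D) := by
    rw [← withDensity_mul _ hD (hDS.div hD)]
    refine withDensity_congr_ae ?_
    filter_upwards [h0, htop] with x hx0 hxt
    exact (ENNReal.mul_div_cancel hx0 hxt).symm
  have hrn := Measure.rnDeriv_withDensity (μ.withDensity D) (hDS.div hD)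
  have := hT.quasiMeasurePreserving.ae (hac.ae_le hrn)
  rw [hq]
  filter_upwards [this] with x hx
  simpa using hx

end DensityTransport

section LogMeasure

instance : SigmaFinite logMeasure := SigmaFinite.withDensity_ofReal _

lemma ae_pos_logMeasure : ∀ᵐ x ∂logMeasure, 0 < x :=
  (withDensity_absolutelyContinuous _ _).ae_le (ae_restrict_mem measurableSet_Ioi)

lemma logMeasure_ne_zero : logMeasure ≠ 0 := by
  intro h
  have hac : volume.restrict (Set.Ioi (0 : ℝ)) ≪ logMeasure := by
    refine withDensity_absolutelyContinuous' (by fun_prop) ?_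
    filter_upwards [ae_restrict_mem measurableSet_Ioi] with x hx
    simpa using hx
  have h1 : volume.restrict (Set.Ioi (0 : ℝ)) Set.univ = 0 := hac (by simp [h])
  simp at h1

/-- `dx/x` is invariant under multiplication by a positive constant. -/
lemma measurePreserving_mul_logMeasure {c : ℝ} (hc : 0 < c) :
    MeasurePreserving (fun x => c * x) logMeasure logMeasure := by
  refine ⟨by fun_prop, ?_⟩
  ext s hs
  have hm : Measurable fun x : ℝ => c * x := by fun_prop
  have hF : Measurable ((s ∩ Set.Ioi 0).indicator fun y : ℝ => ENNReal.ofReal (c / y)) :=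
    (by fun_prop : Measurable fun y : ℝ => ENNReal.ofReal (c / y)).indicator
      (hs.inter measurableSet_Ioi)
  rw [Measure.map_apply hm hs, logMeasure, withDensity_apply _ (hm hs), withDensity_apply _ hs,
    Measure.restrict_restrict (hm hs), Measure.restrict_restrict hs,
    ← lintegral_indicator ((hm hs).inter measurableSet_Ioi),
    ← lintegral_indicator (hs.inter measurableSet_Ioi)]
  calc
    _ = ∫⁻ x, ((s ∩ Set.Ioi 0).indicator fun y : ℝ => ENNReal.ofReal (c / y)) (c * x) := by
      refine lintegral_congr fun x => ?_
      by_cases hx : 0 < x <;> by_cases hxs : c * x ∈ s <;>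
        simp [Set.indicator, hx, hxs, hc, mul_pos_iff_of_pos_left, div_mul_cancel_left₀ hc.ne']
    _ = ∫⁻ y, ((s ∩ Set.Ioi 0).indicator fun y : ℝ => ENNReal.ofReal (c / y)) y
          ∂(volume.map fun x => c * x) := (lintegral_map hF hm).symm
    _ = _ := by
      rw [Real.map_volume_mul_left hc.ne', lintegral_smul_measure, smul_eq_mul,
        ← lintegral_const_mul _ hF]
      refine lintegral_congr fun x => ?_
      by_cases hx : x ∈ s ∩ Set.Ioi 0
      · rw [Set.indicator_of_mem hx, Set.indicator_of_mem hx,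
          ← ENNReal.ofReal_mul (abs_nonneg _), abs_of_pos (inv_pos.2 hc)]
        congr 1
        field_simp
      · rw [Set.indicator_of_notMem hx, Set.indicator_of_notMem hx, mul_zero]

end LogMeasure

variable {V : Type*} (G : SimpleGraph V)

/-- The deformation map as a measurable equivalence of `ℝ^E`. -/
noncomputable def XiEquiv (φ : Sym2 V → ℝ) (γ : ℝ) : (G.edgeSet → ℝ) ≃ᵐ (G.edgeSet → ℝ) where
  toFun := Xi G φ γ
  invFun := Xi G φ (-γ)
  left_inv x := by ext e; simp [Xi, ← mul_assoc, ← Real.exp_add]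
  right_inv x := by ext e; simp [Xi, ← mul_assoc, ← Real.exp_add]
  measurable_toFun := by simp only [Equiv.coe_fn_mk]; unfold Xi; fun_prop
  measurable_invFun := by simp only [Equiv.coe_fn_symm_mk]; unfold Xi; fun_prop

lemma Xi_pos (φ : Sym2 V → ℝ) (γ : ℝ) {x : G.edgeSet → ℝ} (hx : ∀ e, 0 < x e) (e : G.edgeSet) :
    0 < Xi G φ γ x e :=
  mul_pos (Real.exp_pos _) (hx e)

variable [Fintype G.edgeSet]

variable {G} in
lemma treeSum_pos {x : G.edgeSet → ℝ} (hG : G.Connected) (hx : ∀ e, 0 < x e) : 0 < treeSum G x := by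
  obtain ⟨T, hT, htree⟩ := hG.exists_isTree_le
  refine Finset.sum_pos' (fun S _ => ?_)
    ⟨Finset.univ.filter fun e : G.edgeSet => (e : Sym2 V) ∈ T.edgeSet, Finset.mem_univ _, ?_⟩
  · split_ifs
    exacts [Finset.prod_nonneg fun e _ => (hx e).le, le_rfl]
  · rw [if_pos]
    · exact Finset.prod_pos fun e _ => hx e
    · have himage : Subtype.val '' ((Finset.univ.filter fun e : G.edgeSet =>
          (e : Sym2 V) ∈ T.edgeSet : Finset G.edgeSet) : Set G.edgeSet) = T.edgeSet := by
        ext e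
        simpa using fun h => SimpleGraph.edgeSet_mono hT h
      rw [IsSpanningTree, himage, SimpleGraph.fromEdgeSet_edgeSet]
      exact htree

variable [DecidableEq V]

instance sigmaFinite_rho_factor (e₀ e : G.edgeSet) :
    SigmaFinite (if e = e₀ then Measure.dirac 1 else logMeasure : Measure ℝ) := by
  split_ifs <;> infer_instance

instance (e₀ : G.edgeSet) : SigmaFinite (rho G e₀) := by
  unfold rho; infer_instance

lemma rho_ne_zero (e₀ : G.edgeSet) : rho G e₀ ≠ 0 := by
  rw [rho, ← Measure.measure_univ_ne_zero, Measure.pi_univ, Finset.prod_ne_zero_iff]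
  intro e _
  rw [Measure.measure_univ_ne_zero]
  split_ifs
  exacts [(NeZero.ne (Measure.dirac (1 : ℝ))), logMeasure_ne_zero]

lemma ae_pos_rho (e₀ : G.edgeSet) : ∀ᵐ x ∂rho G e₀, ∀ e, 0 < x e := by
  rw [ae_all_iff]
  intro e
  refine (Measure.quasiMeasurePreserving_eval
    (fun e => if e = e₀ then Measure.dirac 1 else logMeasure) e).ae (p := fun y : ℝ => 0 < y) ?_
  split_ifs
  · rw [ae_dirac_iff measurableSet_Ioi]; exact one_pos
  · exact ae_pos_logMeasure

lemma measurePreserving_Xi {φ : Sym2 V → ℝ} {e₀ : G.edgeSet} (h0 : φ (e₀ : Sym2 V) = 0) (γ : ℝ) :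
    MeasurePreserving (Xi G φ γ) (rho G e₀) (rho G e₀) := by
  unfold Xi rho
  refine measurePreserving_pi (fun e => if e = e₀ then Measure.dirac 1 else logMeasure)
    (fun e => if e = e₀ then Measure.dirac 1 else logMeasure)
    (f := fun (e : G.edgeSet) y => Real.exp (γ * φ (e : Sym2 V)) * y) fun e => ?_
  split_ifs with h
  · subst h
    simp only [h0, mul_zero, Real.exp_zero, one_mul]
    exact MeasurePreserving.id _
  · exact measurePreserving_mul_logMeasure (Real.exp_pos _)

section Positivity

variable {G} {x : G.edgeSet → ℝ}

lemma vwt_pos (hG : G.Connected) [Nontrivial V] (hx : ∀ e, 0 < x e) (v : V) :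
    0 < vwt G x v := by
  obtain ⟨w, hw⟩ := hG.preconnected.exists_adj_of_nontrivial v
  refine Finset.sum_pos' (fun e _ => ?_)
    ⟨⟨s(v, w), hw⟩, Finset.mem_univ _, ?_⟩
  · split_ifs
    exacts [(hx e).le, le_rfl]
  · simpa using hx _

variable [Fintype V]

lemma Phi_pos (hG : G.Connected) [Nontrivial V] (a : Sym2 V → ℝ) (hx : ∀ e, 0 < x e) (v : V) :
    0 < Phi G a v x := by
  have hv := fun w => vwt_pos hG hx w
  refine mul_pos (mul_pos (mul_pos ?_ ?_) ?_) (Real.sqrt_pos.2 (treeSum_pos hG hx))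
  · exact Finset.prod_pos fun e _ => Real.rpow_pos_of_pos (hx e) _
  · exact Real.rpow_pos_of_pos (hv v) _
  · exact Finset.prod_pos fun w _ => Real.rpow_pos_of_pos (hv w) _

lemma log_Phi (hG : G.Connected) [Nontrivial V] (a : Sym2 V → ℝ) (hx : ∀ e, 0 < x e) (v : V) :
    Real.log (Phi G a v x) =
      (∑ e : G.edgeSet, a (e : Sym2 V) * Real.log (x e)) + 1 / 2 * Real.log (vwt G x v) -
        (∑ w, (avwt G a w + 1) / 2 * Real.log (vwt G x w)) +
        1 / 2 * Real.log (treeSum G x) := by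
  have hv := fun w => vwt_pos hG hx w
  have ht := treeSum_pos hG hx
  have h1 : ∀ e ∈ Finset.univ, x e ^ a (e : Sym2 V) ≠ 0 := fun e _ =>
    (Real.rpow_pos_of_pos (hx e) _).ne'
  have h2 : ∀ w ∈ Finset.univ.erase v, vwt G x w ^ (-(avwt G a w + 1) / 2) ≠ 0 := fun w _ =>
    (Real.rpow_pos_of_pos (hv w) _).ne'
  have h3 : vwt G x v ^ (-avwt G a v / 2) ≠ 0 := (Real.rpow_pos_of_pos (hv v) _).ne'
  have h4 := Finset.prod_ne_zero_iff.2 h1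
  have h5 := Finset.prod_ne_zero_iff.2 h2
  rw [Phi, Real.log_mul (mul_ne_zero (mul_ne_zero h4 h3) h5) (Real.sqrt_pos.2 ht).ne',
    Real.log_mul (mul_ne_zero h4 h3) h5, Real.log_mul h4 h3, Real.log_prod h1, Real.log_prod h2,
    Real.log_rpow (hv v), Real.log_sqrt ht.le,
    Finset.sum_congr rfl fun e _ => Real.log_rpow (hx e) _,
    Finset.sum_congr rfl fun w _ => Real.log_rpow (hv w) _,
    ← Finset.add_sum_erase _ _ (Finset.mem_univ v)]
  have h6 : ∑ w ∈ Finset.univ.erase v, -(avwt G a w + 1) / 2 * Real.log (vwt G x w) =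
      -∑ w ∈ Finset.univ.erase v, (avwt G a w + 1) / 2 * Real.log (vwt G x w) := by
    rw [← Finset.sum_neg_distrib]
    exact Finset.sum_congr rfl fun w _ => by ring
  rw [h6]
  ring

end Positivity

variable [Fintype V]

lemma measurable_Phi (a : Sym2 V → ℝ) (v : V) : Measurable (Phi G a v) := by
  have hv : ∀ w, Measurable fun x : G.edgeSet → ℝ => vwt G x w := fun w =>
    Finset.measurable_sum _ fun e _ => by split_ifs <;> fun_prop
  have ht : Measurable (treeSum G) :=
    Finset.measurable_sum _ fun T _ => by split_ifs <;> fun_prop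
  unfold Phi
  fun_prop

lemma measurable_interpDens (a : Sym2 V → ℝ) (v₀ v₁ : V) (e₀ : G.edgeSet) :
    Measurable (interpDens G a v₀ v₁ e₀) := by
  have h := measurable_Phi G a
  unfold interpDens
  fun_prop

lemma z_ne_zero (hG : G.Connected) [Nontrivial V] (a : Sym2 V → ℝ) (v : V) (e₀ : G.edgeSet) :
    z G a v e₀ ≠ 0 := by
  intro h
  rw [z, lintegral_eq_zero_iff (measurable_Phi G a v).ennreal_ofReal] at h
  have : ∀ᵐ x ∂rho G e₀, False := by
    filter_upwards [h, ae_pos_rho G e₀] with x hx hpos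
    exact (Phi_pos hG a hpos v).not_ge (ENNReal.ofReal_eq_zero.1 hx)
  exact rho_ne_zero G e₀ (ae_eq_bot.1 (Filter.eventually_false_iff_eq_bot.1 this))

section Interpolation

variable {G} {a : Sym2 V → ℝ} {v₀ v₁ : V} {e₀ : G.edgeSet}

lemma interpDens_ne_zero (hG : G.Connected) [Nontrivial V] (hz0 : z G a v₀ e₀ ≠ ⊤)
    (hz1 : z G a v₁ e₀ ≠ ⊤) {x : G.edgeSet → ℝ} (hx : ∀ e, 0 < x e) :
    interpDens G a v₀ v₁ e₀ x ≠ 0 := by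
  simp [interpDens, ENNReal.rpow_eq_zero_iff, hz0, hz1, Phi_pos hG a hx]

lemma interpDens_ne_top (hG : G.Connected) [Nontrivial V] (x : G.edgeSet → ℝ) :
    interpDens G a v₀ v₁ e₀ x ≠ ⊤ :=
  ENNReal.rpow_ne_top_of_nonneg (by norm_num) <| ENNReal.mul_ne_top
    (ENNReal.div_ne_top ENNReal.ofReal_ne_top (z_ne_zero G hG a v₀ e₀))
    (ENNReal.div_ne_top ENNReal.ofReal_ne_top (z_ne_zero G hG a v₁ e₀))

lemma log_interpDens (hG : G.Connected) [Nontrivial V] (hz0 : z G a v₀ e₀ ≠ ⊤)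
    (hz1 : z G a v₁ e₀ ≠ ⊤) {x : G.edgeSet → ℝ} (hx : ∀ e, 0 < x e) :
    Real.log (interpDens G a v₀ v₁ e₀ x).toReal =
      1 / 2 * (Real.log (Phi G a v₀ x) - Real.log (z G a v₀ e₀).toReal +
        (Real.log (Phi G a v₁ x) - Real.log (z G a v₁ e₀).toReal)) := by
  have h0 := Phi_pos hG a hx v₀
  have h1 := Phi_pos hG a hx v₁
  have k0 := ENNReal.toReal_pos (z_ne_zero G hG a v₀ e₀) hz0
  have k1 := ENNReal.toReal_pos (z_ne_zero G hG a v₁ e₀) hz1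
  rw [interpDens, ← ENNReal.toReal_rpow, ENNReal.toReal_mul, ENNReal.toReal_div,
    ENNReal.toReal_div, ENNReal.toReal_ofReal h0.le, ENNReal.toReal_ofReal h1.le,
    Real.log_rpow (by positivity), Real.log_mul (by positivity) (by positivity),
    Real.log_div h0.ne' k0.ne', Real.log_div h1.ne' k1.ne']

lemma Zc_ne_zero (hG : G.Connected) [Nontrivial V] (hz0 : z G a v₀ e₀ ≠ ⊤)
    (hz1 : z G a v₁ e₀ ≠ ⊤) : Zc G a v₀ v₁ e₀ ≠ 0 := by
  intro h
  rw [Zc, lintegral_eq_zero_iff (measurable_interpDens G a v₀ v₁ e₀)] at h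
  have : ∀ᵐ x ∂rho G e₀, False := by
    filter_upwards [h, ae_pos_rho G e₀] with x hx hpos
    exact interpDens_ne_zero hG hz0 hz1 hpos hx
  exact rho_ne_zero G e₀ (ae_eq_bot.1 (Filter.eventually_false_iff_eq_bot.1 this))

lemma Zc_ne_top (hG : G.Connected) [Nontrivial V] (hz0 : z G a v₀ e₀ ≠ ⊤)
    (hz1 : z G a v₁ e₀ ≠ ⊤) : Zc G a v₀ v₁ e₀ ≠ ⊤ := by
  have hle : ∀ A B : ℝ≥0∞, (A * B) ^ (1 / 2 : ℝ) ≤ A + B := fun A B => by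
    calc
      (A * B) ^ (1 / 2 : ℝ) ≤ ((A + B) ^ (2 : ℝ)) ^ (1 / 2 : ℝ) := by
        refine ENNReal.rpow_le_rpow ?_ (by norm_num)
        rw [ENNReal.rpow_two, sq]
        exact mul_le_mul' le_self_add le_add_self
      _ = A + B := by rw [← ENNReal.rpow_mul]; norm_num
  have hm := fun v => (measurable_Phi G a v).ennreal_ofReal
  refine ne_top_of_le_ne_top (b := ∫⁻ x, (ENNReal.ofReal (Phi G a v₀ x) / z G a v₀ e₀ +
    ENNReal.ofReal (Phi G a v₁ x) / z G a v₁ e₀) ∂rho G e₀) ?_ (lintegral_mono fun x => hle _ _)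
  rw [lintegral_add_left ((hm v₀).div_const _)]
  simp only [div_eq_mul_inv]
  rw [lintegral_mul_const _ (hm v₀), lintegral_mul_const _ (hm v₁)]
  exact ENNReal.add_ne_top.2
    ⟨ENNReal.mul_ne_top hz0 (ENNReal.inv_ne_top.2 (z_ne_zero G hG a v₀ e₀)),
      ENNReal.mul_ne_top hz1 (ENNReal.inv_ne_top.2 (z_ne_zero G hG a v₁ e₀))⟩

/-- The explicit form of the logarithmic density ratio along the deformation. -/
lemma log_interpDens_sub (hG : G.Connected) [Nontrivial V] (hz0 : z G a v₀ e₀ ≠ ⊤)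
    (hz1 : z G a v₁ e₀ ≠ ⊤) {φ : Sym2 V → ℝ} (hne : v₀ ≠ v₁)
    (hφ0 : ∀ e : G.edgeSet, v₀ ∈ (e : Sym2 V) → φ (e : Sym2 V) = 0)
    (hφ1 : ∀ e : G.edgeSet, v₁ ∈ (e : Sym2 V) → φ (e : Sym2 V) = 1) (γ : ℝ)
    {x : G.edgeSet → ℝ} (hx : ∀ e, 0 < x e) :
    Real.log (interpDens G a v₀ v₁ e₀ x).toReal -
      Real.log (interpDens G a v₀ v₁ e₀ (Xi G φ γ x)).toReal = fgamma G a φ v₀ v₁ γ x := by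
  have hy := Xi_pos G φ γ hx
  have hv0 : vwt G (Xi G φ γ x) v₀ = vwt G x v₀ :=
    Finset.sum_congr rfl fun e _ => by
      split_ifs with h
      · simp [Xi, hφ0 e h]
      · rfl
  have hv1 : vwt G (Xi G φ γ x) v₁ = Real.exp γ * vwt G x v₁ := by
    rw [vwt, vwt, Finset.mul_sum]
    refine Finset.sum_congr rfl fun e _ => ?_
    split_ifs with h
    · simp [Xi, hφ1 e h]
    · simp
  have hlog1 : Real.log (vwt G (Xi G φ γ x) v₁) = γ + Real.log (vwt G x v₁) := by
    rw [hv1, Real.log_mul (Real.exp_pos _).ne' (vwt_pos hG hx _).ne', Real.log_exp]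
  have hedge : ∑ e : G.edgeSet, a (e : Sym2 V) * Real.log (Xi G φ γ x e) =
      γ * (∑ e : G.edgeSet, φ (e : Sym2 V) * a (e : Sym2 V)) +
        ∑ e : G.edgeSet, a (e : Sym2 V) * Real.log (x e) := by
    rw [Finset.mul_sum, ← Finset.sum_add_distrib]
    refine Finset.sum_congr rfl fun e _ => ?_
    rw [Xi, Real.log_mul (Real.exp_pos _).ne' (hx e).ne', Real.log_exp]
    ring
  have hsplit : ∀ F : V → ℝ, ∑ w, F w = (∑ w ∈ Finset.univ \ {v₀, v₁}, F w) + (F v₀ + F v₁) :=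
    fun F => by
      rw [← Finset.sum_pair hne, Finset.sum_sdiff (Finset.subset_univ _)]
  have hvert : ∑ v ∈ Finset.univ \ {v₀, v₁}, (avwt G a v + 1) / 2 *
      Real.log (vwt G (Xi G φ γ x) v / vwt G x v) =
      (∑ v ∈ Finset.univ \ {v₀, v₁}, (avwt G a v + 1) / 2 * Real.log (vwt G (Xi G φ γ x) v)) -
      ∑ v ∈ Finset.univ \ {v₀, v₁}, (avwt G a v + 1) / 2 * Real.log (vwt G x v) := by
    rw [← Finset.sum_sub_distrib]
    refine Finset.sum_congr rfl fun v _ => ?_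
    rw [Real.log_div (vwt_pos hG hy v).ne' (vwt_pos hG hx v).ne', mul_sub]
  rw [log_interpDens hG hz0 hz1 hx, log_interpDens hG hz0 hz1 hy, log_Phi hG a hx, log_Phi hG a hx,
    log_Phi hG a hy, log_Phi hG a hy, fgamma, hvert, hedge,
    Real.log_div (treeSum_pos hG hy).ne' (treeSum_pos hG hx).ne',
    hsplit fun w => (avwt G a w + 1) / 2 * Real.log (vwt G x w),
    hsplit fun w => (avwt G a w + 1) / 2 * Real.log (vwt G (Xi G φ γ x) w), hlog1, hv0]
  ring

end Interpolation

end ERRWGraph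

open ERRWGraph in
/-- Lemma 5.5: under Assumption 2.3, `Π^{γφ}` and `ℙ_{v₀,v₁,e₀}` are mutually
absolutely continuous and, for `ρ_{e₀}`-almost all `x`,
`log(dΠ^{γφ}/dℙ_{v₀,v₁,e₀})(Ξ^{γφ}(x)) = f_γ(x)`. -/
theorem deformed_density {V : Type*} [Fintype V] [DecidableEq V]
    (G : SimpleGraph V) [Fintype G.edgeSet] (hG : G.Connected)
    (a φ : Sym2 V → ℝ) (ha : ∀ e ∈ G.edgeSet, 0 < a e)
    (v₀ v₁ : V) (e₀ : G.edgeSet)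
    (hass : Assumption23 G a φ v₀ v₁ e₀)
    (hz0 : z G a v₀ e₀ ≠ ⊤) (hz1 : z G a v₁ e₀ ≠ ⊤) (γ : ℝ) :
    PiGamma G a φ v₀ v₁ e₀ γ ≪ Pm G a v₀ v₁ e₀ ∧
    Pm G a v₀ v₁ e₀ ≪ PiGamma G a φ v₀ v₁ e₀ γ ∧
    ∀ᵐ x ∂rho G e₀,
      logRN (PiGamma G a φ v₀ v₁ e₀ γ) (Pm G a v₀ v₁ e₀) (Xi G φ γ x) =
        fgamma G a φ v₀ v₁ γ x := by
  obtain ⟨hne, -, he₀, -, -, hφ0, hφ1⟩ := hass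
  have : Nontrivial V := ⟨v₀, v₁, hne⟩
  have hZ0 : (Zc G a v₀ v₁ e₀)⁻¹ ≠ 0 := ENNReal.inv_ne_zero.2 (Zc_ne_top hG hz0 hz1)
  have hZt : (Zc G a v₀ v₁ e₀)⁻¹ ≠ ⊤ := ENNReal.inv_ne_top.2 (Zc_ne_zero hG hz0 hz1)
  have hd := measurable_interpDens G a v₀ v₁ e₀
  have hP : Pm G a v₀ v₁ e₀ =
      (rho G e₀).withDensity ((Zc G a v₀ v₁ e₀)⁻¹ • interpDens G a v₀ v₁ e₀) :=
    (withDensity_smul _ hd).symm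
  obtain ⟨h1, h2, h3⟩ := rnDeriv_map_withDensity (XiEquiv G φ γ)
    (measurePreserving_Xi G (hφ0 e₀ he₀) γ) (hd.const_smul (Zc G a v₀ v₁ e₀)⁻¹)
    (by
      filter_upwards [ae_pos_rho G e₀] with x hx
      exact mul_ne_zero hZ0 (interpDens_ne_zero hG hz0 hz1 hx))
    (.of_forall fun x => ENNReal.mul_ne_top hZt (interpDens_ne_top hG x))
  rw [PiGamma, hP]
  refine ⟨h1, h2, ?_⟩
  filter_upwards [h3, ae_pos_rho G e₀] with x hx hpos
  have hy := Xi_pos G φ γ hpos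
  have hdx := ENNReal.toReal_pos (interpDens_ne_zero hG hz0 hz1 hpos)
    (interpDens_ne_top (a := a) (v₀ := v₀) (v₁ := v₁) (e₀ := e₀) hG x)
  have hdy := ENNReal.toReal_pos (interpDens_ne_zero hG hz0 hz1 hy)
    (interpDens_ne_top (a := a) (v₀ := v₀) (v₁ := v₁) (e₀ := e₀) hG (Xi G φ γ x))
  refine Eq.trans (congrArg (fun t : ℝ≥0∞ => Real.log t.toReal) hx) ?_
  change Real.log (_ * interpDens G a v₀ v₁ e₀ x /
    (_ * interpDens G a v₀ v₁ e₀ (Xi G φ γ x))).toReal = _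
  rw [ENNReal.mul_div_mul_left _ _ hZ0 hZt, ENNReal.toReal_div, Real.log_div hdx.ne' hdy.ne',
    log_interpDens_sub hG hz0 hz1 hne hφ0 hφ1 γ hpos]
end

section
/- Let r ≥ 130 be an integer and let a ∈ (0, (r-129)/256). Then there exist l₀ = l₀(r,a) ∈ ℕ and ξ = ξ(r,a) > 0 such that for all ℓ ∈ L_r with |ℓ|_∞ ≥ l₀ and all integers i ≥ i₀(ℓ), there exists a function φ: E_r^{(i)} → [0,1] such that: (a) Assumption 2.3 is fulfilled for the graph G_r^{(i)} with constant edge weights a_e ≡ a, the vertices v₀ = 0 + riℤ² and v₁ = ℓ + riℤ², the reference edge e₀ = {0,(1,0)} + riℤ², and the function φ; and (b) S_φ ≤ 1/( 32·(1+ξ)·log(|ℓ|_∞/r) ), where S_φ := ∑_{v∈V_r^{(i)}} ((a_v+1)/2) · max_{e,e'∈E_r^{(i)}: v∈e, v∈e'} (φ(e) − φ(e'))² with a_v := ∑_{e∈E_r^{(i)}: e∋v} a. -/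
open MeasureTheory
open scoped ENNReal Classical

namespace ERRWGraph

/-- The vertex set `V_r` of the diluted lattice `G_r`. -/
def VrZ (r : ℕ) : Set (ℤ × ℤ) := {x | (r : ℤ) ∣ x.1 ∨ (r : ℤ) ∣ x.2}

/-- The set `L_r = rℤ²`. -/
def LrZ (r : ℕ) : Set (ℤ × ℤ) := {x | (r : ℤ) ∣ x.1 ∧ (r : ℤ) ∣ x.2}

/-- Maximum norm on `ℤ²`. -/
def linf (v : ℤ × ℤ) : ℤ := max |v.1| |v.2|

/-- Adjacency in `G_r`. -/
def AdjZ (r : ℕ) (u v : ℤ × ℤ) : Prop :=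
  u ∈ VrZ r ∧ v ∈ VrZ r ∧ (u.1 - v.1) ^ 2 + (u.2 - v.2) ^ 2 = 1

/-- The fundamental domain `Ṽ_r^{(i)}` of the periodic box. -/
def tildeV (r i : ℕ) : Set (ℤ × ℤ) :=
  {v | v ∈ VrZ r ∧
    ((r : ℤ) * ((i / 2 : ℕ) : ℤ) - (r : ℤ) * (i : ℤ) < v.1 ∧
      v.1 ≤ (r : ℤ) * ((i / 2 : ℕ) : ℤ)) ∧
    ((r : ℤ) * ((i / 2 : ℕ) : ℤ) - (r : ℤ) * (i : ℤ) < v.2 ∧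
      v.2 ≤ (r : ℤ) * ((i / 2 : ℕ) : ℤ))}

/-- `i ≥ i₀(ℓ)`: the box size `i` is large enough that `ℓ` and all its four
neighbours in `G_r` lie in the fundamental domain `Ṽ_r^{(i)}`. -/
def i0cond (r : ℕ) (ℓ : ℤ × ℤ) (i : ℕ) : Prop :=
  1 < i ∧ ℓ ∈ tildeV r i ∧ ℓ + (1, 0) ∈ tildeV r i ∧ ℓ - (1, 0) ∈ tildeV r i ∧
    ℓ + (0, 1) ∈ tildeV r i ∧ ℓ - (0, 1) ∈ tildeV r i

/-- Projection `ℤ² → ℤ²/(nℤ²)`. -/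
def proj (n : ℕ) (p : ℤ × ℤ) : ZMod n × ZMod n := ((p.1 : ZMod n), (p.2 : ZMod n))

/-- The periodic box `G_r^{(i)}` as a graph on `ℤ²/(riℤ²)`: two classes are adjacent
iff they are the images of the endpoints of an edge of `G_r`. -/
def Gper (r i : ℕ) : SimpleGraph (ZMod (r * i) × ZMod (r * i)) :=
  SimpleGraph.fromRel fun ub vb =>
    ∃ u v : ℤ × ℤ, AdjZ r u v ∧ proj (r * i) u = ub ∧ proj (r * i) v = vb

end ERRWGraph

namespace ERRWGraph

section Profile

/-- The normalizing sum `∑_{k<N} 1/(2k+1)`. -/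
noncomputable def oddHarmonic (N : ℕ) : ℝ := ∑ k ∈ Finset.range N, 1 / (2 * (k : ℝ) + 1)

lemma log_le_two_mul_oddHarmonic {N : ℕ} (hN : 0 < N) :
    Real.log N ≤ 2 * oddHarmonic N := by
  have h1 : Real.log N ≤ Real.log ((N + 1 : ℕ) : ℝ) :=
    Real.log_le_log (by exact_mod_cast hN) (by exact_mod_cast Nat.le_succ N)
  refine h1.trans ((log_add_one_le_harmonic N).trans ?_)
  rw [oddHarmonic, Finset.mul_sum, harmonic]
  push_cast
  refine Finset.sum_le_sum fun k _ => ?_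
  rw [mul_one_div, inv_eq_one_div, div_le_div_iff₀ (by positivity) (by positivity)]
  linarith

/-- The increment of the radial deformation profile at vertices of norm `s`. -/
noncomputable def profileStep (r N s : ℕ) : ℝ :=
  if r ∣ s ∨ r * N ≤ s then 0
  else 1 / ((2 * ((s / r : ℕ) : ℝ) + 1) * ((r - 1) * oddHarmonic N))

/-- The radial deformation profile. -/
noncomputable def profile (r N s : ℕ) : ℝ := ∑ t ∈ Finset.range (s + 1), profileStep r N t

lemma oddHarmonic_nonneg (N : ℕ) : 0 ≤ oddHarmonic N :=
  Finset.sum_nonneg fun _ _ => by positivity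

lemma profileStep_nonneg {r : ℕ} (hr : 1 ≤ r) (N s : ℕ) : 0 ≤ profileStep r N s := by
  have h : (0 : ℝ) ≤ r - 1 := sub_nonneg.2 (by exact_mod_cast hr)
  have := oddHarmonic_nonneg N
  unfold profileStep
  split_ifs <;> positivity

lemma sum_range_mul_not_dvd {r : ℕ} (hr : 1 ≤ r) (f : ℕ → ℝ) (N : ℕ) :
    ∑ s ∈ Finset.range (r * N), (if r ∣ s then 0 else f (s / r)) =
      (r - 1) * ∑ k ∈ Finset.range N, f k := by
  induction N with
  | zero => simp
  | succ N ih =>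
    rw [Nat.mul_succ, Finset.sum_range_add, ih, Finset.sum_range_succ, mul_add]
    congr 1
    obtain ⟨m, rfl⟩ : ∃ m, r = m + 1 := ⟨r - 1, by omega⟩
    rw [Finset.sum_range_succ']
    have h : ∀ t ∈ Finset.range m,
        (if m + 1 ∣ (m + 1) * N + (t + 1) then 0 else f (((m + 1) * N + (t + 1)) / (m + 1)))
          = f N := by
      intro t ht
      rw [Finset.mem_range] at ht
      have h1 : ¬ m + 1 ∣ (m + 1) * N + (t + 1) := by
        rw [Nat.dvd_add_right (Dvd.intro _ rfl)]
        exact fun h => absurd (Nat.le_of_dvd (by omega) h) (by omega)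
      rw [if_neg h1, Nat.mul_add_div (by omega), Nat.div_eq_of_lt (by omega), add_zero]
    rw [Finset.sum_congr rfl h]
    simp

lemma sum_range_profileStep {r N : ℕ} (hr : 2 ≤ r) (hN : 0 < N) :
    ∑ s ∈ Finset.range (r * N), profileStep r N s = 1 := by
  have hr' : (0 : ℝ) < r - 1 := sub_pos.2 (by exact_mod_cast hr)
  have hpos : 0 < oddHarmonic N :=
    Finset.sum_pos (fun _ _ => by positivity) ⟨0, by simpa using hN⟩
  have h := sum_range_mul_not_dvd (r := r) (by omega)
    (fun k => 1 / ((2 * (k : ℝ) + 1) * ((r - 1) * oddHarmonic N))) N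
  calc _ = _ := Finset.sum_congr rfl fun s hs => ?_
    _ = _ := h
    _ = (r - 1) * (oddHarmonic N * (1 / ((r - 1) * oddHarmonic N))) := by
      congr 1
      conv_rhs => rw [oddHarmonic, Finset.sum_mul]
      exact Finset.sum_congr rfl fun k _ => (one_div_mul_one_div _ _).symm
    _ = 1 := by field_simp
  have : ¬ r * N ≤ s := by simpa using hs
  simp [profileStep, this]

lemma profile_zero (r N : ℕ) : profile r N 0 = 0 := by
  simp [profile, profileStep]

lemma profile_eq_one {r N s : ℕ} (hr : 2 ≤ r) (hN : 0 < N) (hs : r * N ≤ s + 1) :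
    profile r N s = 1 := by
  rw [← sum_range_profileStep hr hN, profile]
  refine (Finset.sum_subset (Finset.range_subset_range.2 hs) fun t _ ht => ?_).symm
  rw [Finset.mem_range, not_lt] at ht
  simp [profileStep, ht]

lemma profile_mono {r : ℕ} (hr : 1 ≤ r) (N : ℕ) : Monotone (profile r N) := fun s t h =>
  Finset.sum_le_sum_of_subset_of_nonneg (Finset.range_subset_range.2 (by omega))
    fun _ _ _ => profileStep_nonneg hr N _

lemma profile_mem_Icc {r N : ℕ} (hr : 2 ≤ r) (hN : 0 < N) (s : ℕ) :
    profile r N s ∈ Set.Icc (0 : ℝ) 1 :=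
  ⟨Finset.sum_nonneg fun _ _ => profileStep_nonneg (by omega) N _,
    (profile_mono (by omega) N (le_max_left s (r * N))).trans_eq
      (profile_eq_one hr hN ((le_max_right s (r * N)).trans (Nat.le_succ _)))⟩

lemma sq_profile_sub_le {r s p q : ℕ} (N : ℕ)
    (hp : p = s ∨ p + 1 = s) (hq : q = s ∨ q + 1 = s) :
    (profile r N p - profile r N q) ^ 2 ≤ profileStep r N s ^ 2 := by
  have key : ∀ t, t + 1 = s → profile r N s = profile r N t + profileStep r N s := by
    rintro t rfl
    exact Finset.sum_range_succ _ _
  rcases hp with rfl | hp <;> rcases hq with rfl | hq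
  · simpa using sq_nonneg (profileStep r N _)
  · rw [key q hq]; simp
  · rw [key p hp]; simp
  · obtain rfl : p = q := by omega
    simpa using sq_nonneg (profileStep r N s)

/-- Energy of the radial profile, for spheres with at most `4 (2 ⌊s/r⌋ + 1)` points. -/
lemma sum_range_mul_sq_profileStep_le {r N : ℕ} (hr : 2 ≤ r) (hN : 2 ≤ N) (b : ℕ → ℝ)
    (hb : ∀ s, ¬ r ∣ s → b s ≤ 4 * (2 * ((s / r : ℕ) : ℝ) + 1)) :
    ∑ s ∈ Finset.range (r * N), b s * profileStep r N s ^ 2 ≤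
      8 / ((r - 1) * Real.log N) := by
  have hr' : (0 : ℝ) < r - 1 := sub_pos.2 (by exact_mod_cast hr)
  have hlog : 0 < Real.log N := Real.log_pos (by exact_mod_cast hN)
  have hle := log_le_two_mul_oddHarmonic (N := N) (by omega)
  have hpos : 0 < oddHarmonic N := by linarith
  have h := sum_range_mul_not_dvd (r := r) (by omega)
    (fun k => 4 * (1 / (2 * (k : ℝ) + 1)) * (1 / ((r - 1) * oddHarmonic N) ^ 2)) N
  calc _ ≤ _ := Finset.sum_le_sum fun s hs => ?_
    _ = _ := h
    _ = (r - 1) * (4 * oddHarmonic N * (1 / ((r - 1) * oddHarmonic N) ^ 2)) := by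
      rw [← Finset.sum_mul, ← Finset.mul_sum]; rfl
    _ = 4 / ((r - 1) * oddHarmonic N) := by field_simp
    _ ≤ 8 / ((r - 1) * Real.log N) := by
      rw [div_le_div_iff₀ (by positivity) (by positivity)]
      nlinarith
  have hs' : ¬ r * N ≤ s := by simpa using hs
  by_cases hd : r ∣ s
  · simp [profileStep, hd]
  · simp only [profileStep, hd, hs', or_self, if_false]
    refine (mul_le_mul_of_nonneg_right (hb s hd) (sq_nonneg _)).trans_eq ?_
    field_simp

end Profile

section Graph

variable {V : Type*} (G : SimpleGraph V)

lemma avwt_const_le [DecidableEq V] [Fintype G.edgeSet] (a : ℝ) (ha : 0 ≤ a) (v : V) (S : Finset V)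
    (hS : ∀ w, G.Adj v w → w ∈ S) : avwt G (fun _ => a) v ≤ S.card * a := by
  rw [avwt, ← Finset.sum_filter, Finset.sum_const, nsmul_eq_mul]
  refine mul_le_mul_of_nonneg_right ?_ ha
  norm_cast
  refine le_trans (b := (S.image fun w => s(v, w)).card) ?_ Finset.card_image_le
  refine Finset.card_le_card_of_injOn Subtype.val ?_ Subtype.val_injective.injOn
  rintro ⟨e, he⟩ hv
  obtain ⟨w, rfl⟩ : v ∈ e := by simpa using hv
  simpa using ⟨w, hS w (by simpa using he), Or.inl rfl⟩

lemma maxsq_le (φ : Sym2 V → ℝ) (v : V) (c : ℝ) (hc : 0 ≤ c)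
    (h : ∀ w w', G.Adj v w → G.Adj v w' → (φ s(v, w) - φ s(v, w')) ^ 2 ≤ c) :
    maxsq G φ v ≤ c := by
  refine Real.sSup_le ?_ hc
  rintro _ ⟨⟨⟨e, he⟩, ⟨e', he'⟩⟩, ⟨hv, hv'⟩, rfl⟩
  obtain ⟨w, rfl⟩ : v ∈ e := hv
  obtain ⟨w', rfl⟩ : v ∈ e' := hv'
  exact h w w' he he'

end Graph

section Torus

/-- The maximum norm on the torus `(ℤ/n)²`. -/
def torusNorm {n : ℕ} (x : ZMod n × ZMod n) : ℕ :=
  max x.1.valMinAbs.natAbs x.2.valMinAbs.natAbs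

/-- Divisibility by `r` of a residue class modulo a multiple of `r`. -/
def ResDvd (r : ℕ) {n : ℕ} (x : ZMod n) : Prop := (r : ℤ) ∣ x.valMinAbs

lemma resDvd_intCast {r i : ℕ} (u : ℤ) :
    ResDvd r (u : ZMod (r * i)) ↔ (r : ℤ) ∣ u := by
  have h : ((r * i : ℕ) : ℤ) ∣ u - (u : ZMod (r * i)).valMinAbs := by
    rw [← ZMod.intCast_eq_intCast_iff_dvd_sub, ZMod.coe_valMinAbs]
  have h' : (r : ℤ) ∣ u - (u : ZMod (r * i)).valMinAbs :=
    (Dvd.intro (i : ℤ) (by push_cast; rfl)).trans h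
  exact (dvd_iff_dvd_of_dvd_sub h').symm

lemma natAbs_valMinAbs_add_int_le {n : ℕ} [NeZero n] (x : ZMod n) (d : ℤ) (hd : d.natAbs ≤ 1) :
    (x + d).valMinAbs.natAbs ≤ x.valMinAbs.natAbs + 1 := by
  have h : (d : ZMod n).valMinAbs.natAbs ≤ 1 := by
    have h1 : (1 : ZMod n).valMinAbs.natAbs ≤ 1 := by
      rw [ZMod.valMinAbs_natAbs_eq_min]
      refine (min_le_left _ _).trans ?_
      rw [ZMod.val_one_eq_one_mod]
      exact Nat.mod_le _ _
    obtain rfl | rfl | rfl : d = 0 ∨ d = 1 ∨ d = -1 := by omega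
    · simp
    · simpa using h1
    · simpa [ZMod.natAbs_valMinAbs_neg] using h1
  have := ZMod.natAbs_valMinAbs_add_le x (d : ZMod n)
  omega

/-- Adjacency in the periodic box, in terms of residues. -/
lemma Gper_adj_iff {r i : ℕ} (x y : ZMod (r * i) × ZMod (r * i)) :
    (Gper r i).Adj x y ↔ x ≠ y ∧
      ∃ u v : ℤ × ℤ, AdjZ r u v ∧ proj (r * i) u = x ∧ proj (r * i) v = y := by
  rw [Gper, SimpleGraph.fromRel_adj]
  refine and_congr_right fun _ => or_iff_left_of_imp ?_
  rintro ⟨u, v, ⟨hu, hv, h⟩, rfl, rfl⟩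
  exact ⟨v, u, ⟨hv, hu, by linarith⟩, rfl, rfl⟩

lemma sq_add_sq_eq_one_cases {p q : ℤ} (h : p ^ 2 + q ^ 2 = 1) :
    (p.natAbs = 1 ∧ q = 0) ∨ (p = 0 ∧ q.natAbs = 1) := by
  have hp1 : p ≤ 1 := by nlinarith [sq_nonneg q]
  have hp2 : -1 ≤ p := by nlinarith [sq_nonneg q]
  have hq1 : q ≤ 1 := by nlinarith [sq_nonneg p]
  have hq2 : -1 ≤ q := by nlinarith [sq_nonneg p]
  interval_cases p <;> interval_cases q <;> simp_all

lemma Gper_adj_cases {r i : ℕ} (hr : 2 ≤ r) {x y : ZMod (r * i) × ZMod (r * i)}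
    (h : (Gper r i).Adj x y) :
    (ResDvd r x.2 ∧ ∃ d : ℤ, d.natAbs = 1 ∧ y = (x.1 + d, x.2)) ∨
      (ResDvd r x.1 ∧ ∃ d : ℤ, d.natAbs = 1 ∧ y = (x.1, x.2 + d)) := by
  obtain ⟨-, ⟨u₁, u₂⟩, ⟨v₁, v₂⟩, ⟨hu, hv, huv⟩, rfl, rfl⟩ := (Gper_adj_iff x y).1 h
  simp only [VrZ, Set.mem_ofPred_eq] at hu hv huv
  simp only [proj, resDvd_intCast]
  have hnot : ∀ p q : ℤ, (r : ℤ) ∣ p → (r : ℤ) ∣ q → (p - q).natAbs ≠ 1 := by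
    intro p q hp hq h1
    have h2 := Int.natAbs_dvd_natAbs.2 (dvd_sub hp hq)
    rw [h1, Int.natAbs_natCast] at h2
    exact absurd (Nat.le_of_dvd one_pos h2) (by omega)
  rcases sq_add_sq_eq_one_cases huv with ⟨h1, h2⟩ | ⟨h1, h2⟩
  · left
    obtain rfl : u₂ = v₂ := by omega
    refine ⟨?_, v₁ - u₁, by omega, by simp⟩
    rcases hu with hu | hu
    · rcases hv with hv | hv
      · exact absurd h1 (hnot _ _ hu hv)
      · exact hv
    · exact hu
  · right
    obtain rfl : u₁ = v₁ := by omega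
    refine ⟨?_, v₂ - u₂, by omega, by simp⟩
    rcases hu with hu | hu
    · exact hu
    · rcases hv with hv | hv
      · exact hv
      · exact absurd h2 (hnot _ _ hu hv)

lemma torusNorm_le_of_adj {r i : ℕ} [NeZero (r * i)] (hr : 2 ≤ r)
    {x y : ZMod (r * i) × ZMod (r * i)} (h : (Gper r i).Adj x y) :
    torusNorm y ≤ torusNorm x + 1 := by
  obtain ⟨-, d, hd, rfl⟩ | ⟨-, d, hd, rfl⟩ := Gper_adj_cases hr h
  · have := natAbs_valMinAbs_add_int_le x.1 d hd.le
    simp only [torusNorm]; omega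
  · have := natAbs_valMinAbs_add_int_le x.2 d hd.le
    simp only [torusNorm]; omega

lemma min_torusNorm_of_adj {r i : ℕ} [NeZero (r * i)] (hr : 2 ≤ r)
    {x y : ZMod (r * i) × ZMod (r * i)} (h : (Gper r i).Adj x y) :
    min (torusNorm x) (torusNorm y) = torusNorm x ∨
      min (torusNorm x) (torusNorm y) + 1 = torusNorm x := by
  have := torusNorm_le_of_adj hr h.symm
  omega

lemma not_resDvd_and {r n : ℕ} {x : ZMod n × ZMod n} (hx : ¬ r ∣ torusNorm x) :
    ¬ (ResDvd r x.1 ∧ ResDvd r x.2) := by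
  rintro ⟨h1, h2⟩
  rw [ResDvd, Int.natCast_dvd] at h1 h2
  rcases max_choice x.1.valMinAbs.natAbs x.2.valMinAbs.natAbs with h | h
  · exact hx (by rwa [torusNorm, h])
  · exact hx (by rwa [torusNorm, h])

/-- Vertices in the interior of the stretched edges have degree at most two. -/
lemma avwt_Gper_le {r i : ℕ} [NeZero (r * i)] (hr : 2 ≤ r) {a : ℝ} (ha : 0 ≤ a)
    [Fintype (Gper r i).edgeSet] {x : ZMod (r * i) × ZMod (r * i)} (hx : ¬ r ∣ torusNorm x) :
    avwt (Gper r i) (fun _ => a) x ≤ 2 * a := by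
  have key : ∃ S : Finset (ZMod (r * i) × ZMod (r * i)), S.card ≤ 2 ∧
      ∀ y, (Gper r i).Adj x y → y ∈ S := by
    have hd' : ∀ d : ℤ, d.natAbs = 1 → d = 1 ∨ d = -1 := fun d hd => by omega
    by_cases h : ResDvd r x.2
    · refine ⟨{(x.1 + (1 : ℤ), x.2), (x.1 + (-1 : ℤ), x.2)}, Finset.card_le_two, fun y hy => ?_⟩
      obtain ⟨-, d, hd, rfl⟩ | ⟨h', -⟩ := Gper_adj_cases hr hy
      · rcases hd' d hd with rfl | rfl <;> simp
      · exact absurd ⟨h', h⟩ (not_resDvd_and hx)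
    · refine ⟨{(x.1, x.2 + (1 : ℤ)), (x.1, x.2 + (-1 : ℤ))}, Finset.card_le_two, fun y hy => ?_⟩
      obtain ⟨h', -⟩ | ⟨-, d, hd, rfl⟩ := Gper_adj_cases hr hy
      · exact absurd h' h
      · rcases hd' d hd with rfl | rfl <;> simp
  obtain ⟨S, hS, hadj⟩ := key
  refine (avwt_const_le _ a ha x S hadj).trans (mul_le_mul_of_nonneg_right ?_ ha)
  exact_mod_cast hS

/-- Number of vertices of the diluted torus on a sphere not meeting lattice corners. -/
lemma card_sphere_le {r n : ℕ} [NeZero n] (hr : 1 ≤ r) {s : ℕ} (hs : ¬ r ∣ s) :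
    (Finset.univ.filter fun x : ZMod n × ZMod n =>
      (ResDvd r x.1 ∨ ResDvd r x.2) ∧ torusNorm x = s).card ≤ 4 * (2 * (s / r) + 1) := by
  let J : Finset ℤ := (Finset.Icc (-((s / r : ℕ) : ℤ)) ((s / r : ℕ) : ℤ)).image ((r : ℤ) * ·)
  have hJ : J.card ≤ 2 * (s / r) + 1 := by
    refine Finset.card_image_le.trans ?_
    rw [Int.card_Icc]; omega
  let T : Finset ℤ := {(s : ℤ), -(s : ℤ)}
  have hT : T.card ≤ 2 := Finset.card_le_two
  have hmem : ∀ p q : ℤ, (r : ℤ) ∣ p → max p.natAbs q.natAbs = s → p ∈ J ∧ q ∈ T := by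
    rintro p q ⟨j, rfl⟩ hpq
    have h1 : ((r : ℤ) * j).natAbs = r * j.natAbs := by simp [Int.natAbs_mul]
    have h2 : r * j.natAbs ≠ s := fun h => hs ⟨_, h.symm⟩
    have h3 : r * j.natAbs ≤ s := by omega
    have h4 : j.natAbs ≤ s / r := (Nat.le_div_iff_mul_le (by omega)).2 (by rwa [mul_comm])
    refine ⟨Finset.mem_image.2 ⟨j, Finset.mem_Icc.2 (by omega), rfl⟩, ?_⟩
    have h5 : q.natAbs = s := by omega
    simp only [T, Finset.mem_insert, Finset.mem_singleton]
    omega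
  calc _ ≤ (J ×ˢ T ∪ T ×ˢ J).card := by
        refine Finset.card_le_card_of_injOn
          (fun x => (x.1.valMinAbs, x.2.valMinAbs)) ?_ ?_
        · rintro ⟨x, y⟩ hxy
          simp only [Finset.coe_filter, Finset.mem_univ, true_and, Set.mem_ofPred_eq] at hxy
          obtain ⟨h | h, hn⟩ := hxy
          · exact Finset.mem_union_left _ (Finset.mem_product.2 (hmem _ _ h hn))
          · exact Finset.mem_union_right _ (Finset.mem_product.2
              (hmem _ _ h (by rwa [max_comm])).symm)
        · rintro ⟨x, y⟩ - ⟨z, w⟩ - h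
          simpa [ZMod.valMinAbs_inj] using h
    _ ≤ J.card * T.card + T.card * J.card := by
        refine (Finset.card_union_le _ _).trans ?_
        rw [Finset.card_product, Finset.card_product]
    _ ≤ _ := by nlinarith

/-- The radial deformation function on the edges of the torus. -/
noncomputable def deformation (r N n : ℕ) : Sym2 (ZMod n × ZMod n) → ℝ :=
  Sym2.lift ⟨fun x y => profile r N (min (torusNorm x) (torusNorm y)),
    fun x y => by simp only [min_comm]⟩

lemma maxsq_deformation_le {r i : ℕ} [NeZero (r * i)] (hr : 2 ≤ r) (N : ℕ)
    (x : ZMod (r * i) × ZMod (r * i)) :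
    maxsq (Gper r i) (deformation r N (r * i)) x ≤
      if ResDvd r x.1 ∨ ResDvd r x.2 then profileStep r N (torusNorm x) ^ 2 else 0 := by
  refine maxsq_le _ _ _ _ (by split_ifs <;> positivity) fun w w' hw hw' => ?_
  have hx : ResDvd r x.1 ∨ ResDvd r x.2 := by
    obtain ⟨h, -⟩ | ⟨h, -⟩ := Gper_adj_cases hr hw
    exacts [Or.inr h, Or.inl h]
  rw [if_pos hx]
  exact sq_profile_sub_le N (min_torusNorm_of_adj hr hw) (min_torusNorm_of_adj hr hw')

lemma maxsq_nonneg {V : Type*} (G : SimpleGraph V) (φ : Sym2 V → ℝ) (v : V) :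
    0 ≤ maxsq G φ v := by
  refine Real.sSup_nonneg ?_
  rintro _ ⟨p, -, rfl⟩
  positivity

lemma Sphi_deformation_le {r i : ℕ} [NeZero (r * i)] [Fintype (Gper r i).edgeSet]
    (hr : 2 ≤ r) {N : ℕ} (hN : 2 ≤ N) {a : ℝ} (ha : 0 ≤ a) :
    Sphi (Gper r i) (fun _ => a) (deformation r N (r * i)) ≤
      4 * (2 * a + 1) / ((r - 1) * Real.log N) := by
  set R : Finset (ZMod (r * i) × ZMod (r * i)) :=
    Finset.univ.filter fun x => ResDvd r x.1 ∨ ResDvd r x.2 with hR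
  have hstep : ∀ s, s ∉ Finset.range (r * N) → profileStep r N s = 0 := fun s hs => by
    rw [Finset.mem_range, not_lt] at hs
    simp [profileStep, hs]
  have hterm : ∀ x, (avwt (Gper r i) (fun _ => a) x + 1) / 2 *
      maxsq (Gper r i) (deformation r N (r * i)) x ≤ (2 * a + 1) / 2 *
        if ResDvd r x.1 ∨ ResDvd r x.2 then profileStep r N (torusNorm x) ^ 2 else 0 := by
    intro x
    have hm := maxsq_deformation_le hr N x
    have hm0 := maxsq_nonneg (Gper r i) (deformation r N (r * i)) x
    by_cases hx : r ∣ torusNorm x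
    · have h0 : profileStep r N (torusNorm x) = 0 := by simp [profileStep, hx]
      simp only [h0, ne_eq, OfNat.ofNat_ne_zero, not_false_eq_true, zero_pow, ite_self] at hm ⊢
      rw [le_antisymm hm hm0]; simp
    · have := avwt_Gper_le hr ha hx
      exact mul_le_mul (by linarith) hm hm0 (by positivity)
  calc _ ≤ _ := Finset.sum_le_sum fun x _ => hterm x
    _ = (2 * a + 1) / 2 * ∑ x ∈ R, profileStep r N (torusNorm x) ^ 2 := by
      rw [← Finset.mul_sum, hR, Finset.sum_filter]
    _ = (2 * a + 1) / 2 * ∑ s ∈ Finset.range (r * N),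
        ((R.filter fun x => torusNorm x = s).card : ℝ) * profileStep r N s ^ 2 := by
      congr 1
      rw [← Finset.sum_filter_add_sum_filter_not R (fun x => torusNorm x ∈ Finset.range (r * N)),
        Finset.sum_eq_zero (s := R.filter fun x => ¬ _), add_zero,
        ← Finset.sum_fiberwise_of_maps_to (s := R.filter _) (t := Finset.range (r * N))
          (g := torusNorm) (fun x hx => (Finset.mem_filter.1 hx).2)]
      · refine Finset.sum_congr rfl fun s hs => ?_
        rw [Finset.filter_filter, ← nsmul_eq_mul, ← Finset.sum_const]
        refine Finset.sum_congr ?_ fun x hx => ?_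
        · ext x
          simp only [Finset.mem_filter]
          constructor
          · exact fun h => ⟨h.1, h.2.2⟩
          · exact fun h => ⟨h.1, h.2 ▸ hs, h.2⟩
        · rw [(Finset.mem_filter.1 hx).2]
      · intro x hx
        rw [hstep _ (Finset.mem_filter.1 hx).2]; simp
    _ ≤ (2 * a + 1) / 2 * (8 / ((r - 1) * Real.log N)) := by
      refine mul_le_mul_of_nonneg_left ?_ (by positivity)
      refine sum_range_mul_sq_profileStep_le hr hN _ fun s hs => ?_
      rw [hR, Finset.filter_filter]
      exact_mod_cast card_sphere_le (by omega) hs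
    _ = _ := by ring

/-- The point reflection exchanging `0` and `p` is an automorphism of the periodic box. -/
lemma isAut_reflection {r i : ℕ} {p : ℤ × ℤ} (hp : p ∈ LrZ r) (a : ℝ) :
    IsAut (Gper r i) (fun _ => a) (fun x => proj (r * i) p - x) := by
  have hinv : Function.Involutive
      (fun x : ZMod (r * i) × ZMod (r * i) => proj (r * i) p - x) := fun x => sub_sub_cancel _ _
  have hadj : ∀ x y, (Gper r i).Adj x y →
      (Gper r i).Adj (proj (r * i) p - x) (proj (r * i) p - y) := by
    intro x y h
    obtain ⟨hne, u, v, ⟨hu, hv, huv⟩, rfl, rfl⟩ := (Gper_adj_iff x y).1 h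
    refine (Gper_adj_iff _ _).2 ⟨fun h => hne (sub_right_injective h), p - u, p - v,
      ⟨?_, ?_, ?_⟩, ?_, ?_⟩
    · exact hu.imp (dvd_sub hp.1) (dvd_sub hp.2)
    · exact hv.imp (dvd_sub hp.1) (dvd_sub hp.2)
    · simp only [Prod.fst_sub, Prod.snd_sub]; linarith
    · simp [proj]
    · simp [proj]
  refine ⟨hinv.bijective, fun x y => ⟨fun h => ?_, hadj x y⟩, fun _ _ _ => rfl⟩
  simpa using hadj _ _ h

lemma torusNorm_proj {r i : ℕ} [NeZero (r * i)] {p : ℤ × ℤ} (hpr : p ∈ LrZ r)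
    (hp : i0cond r p i) :
    (torusNorm (proj (r * i) p) : ℤ) = linf p := by
  obtain ⟨-, -, ⟨-, h1, -⟩, ⟨-, h2, -⟩, ⟨-, -, h3⟩, ⟨-, -, h4⟩⟩ := hp
  simp only [Prod.fst_add, Prod.fst_sub, Prod.snd_add, Prod.snd_sub] at h1 h2 h3 h4
  have hb : 2 * ((r : ℤ) * ((i / 2 : ℕ) : ℤ)) ≤ r * i := by
    have : (2 : ℤ) * ((i / 2 : ℕ) : ℤ) ≤ i := by omega
    nlinarith
  have hcoord : ∀ t : ℤ, (r : ℤ) ∣ t →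
      (r : ℤ) * ((i / 2 : ℕ) : ℤ) - (r : ℤ) * (i : ℤ) < t - 1 →
      t + 1 ≤ (r : ℤ) * ((i / 2 : ℕ) : ℤ) → (t : ZMod (r * i)).valMinAbs = t := by
    rintro _ ⟨j, rfl⟩ ht1 ht2
    refine (ZMod.valMinAbs_spec _ _).2 ⟨rfl, ?_, ?_⟩
    · have hr : (0 : ℤ) < r := by
        have := left_ne_zero_of_mul (NeZero.ne (r * i))
        omega
      have h : ((i / 2 : ℕ) : ℤ) - i < j :=
        lt_of_mul_lt_mul_left (by rw [mul_sub]; linarith) hr.le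
      have h' : -(i : ℤ) < 2 * j := by omega
      push_cast
      nlinarith
    · push_cast; linarith
  simp only [torusNorm, proj, linf, hcoord _ hpr.1 h2.1 h1.2, hcoord _ hpr.2 h4.1 h3.2, Nat.cast_max,
    Int.natCast_natAbs]

lemma exists_linf_eq_mul {r : ℕ} {p : ℤ × ℤ} (hp : p ∈ LrZ r) : ∃ N : ℕ, linf p = r * N := by
  have hd : (r : ℤ) ∣ linf p := by
    rcases max_choice |p.1| |p.2| with h | h
    · rw [linf, h, dvd_abs]; exact hp.1
    · rw [linf, h, dvd_abs]; exact hp.2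
  have h0 : 0 ≤ linf p := (abs_nonneg p.1).trans (le_max_left _ _)
  lift linf p to ℕ using h0 with m
  obtain ⟨N, rfl⟩ := Int.natCast_dvd_natCast.1 hd
  exact ⟨N, Nat.cast_mul r N⟩

lemma assumption23_deformation {r i N : ℕ} [NeZero (r * i)] (hr : 2 ≤ r) (hN : 0 < N) (a : ℝ)
    {p : ℤ × ℤ} (hpr : p ∈ LrZ r) (hp : torusNorm (proj (r * i) p) = r * N)
    (e₀ : (Gper r i).edgeSet)
    (he₀ : proj (r * i) (0, 0) ∈ (e₀ : Sym2 (ZMod (r * i) × ZMod (r * i)))) :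
    Assumption23 (Gper r i) (fun _ => a) (deformation r N (r * i)) (proj (r * i) (0, 0))
      (proj (r * i) p) e₀ := by
  have h0 : torusNorm (proj (r * i) (0, 0)) = 0 := by simp [torusNorm, proj]
  have hrN : 2 ≤ r * N := by nlinarith
  refine ⟨fun h => ?_, fun h => ?_, he₀,
    ⟨fun x => proj (r * i) p - x, isAut_reflection hpr a, by ext <;> simp [proj],
      by ext <;> simp [proj]⟩, ?_, ?_, ?_⟩
  · rw [← h] at hp; omega
  · have := torusNorm_le_of_adj hr h
    omega
  · rintro ⟨⟨x, y⟩, -⟩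
    exact profile_mem_Icc hr hN _
  · rintro ⟨e, he⟩ hv
    obtain ⟨w, rfl⟩ : proj (r * i) (0, 0) ∈ e := hv
    change profile r N (min _ _) = 0
    rw [h0, Nat.zero_min, profile_zero]
  · rintro ⟨e, he⟩ hv
    obtain ⟨w, rfl⟩ : proj (r * i) p ∈ e := hv
    have := min_torusNorm_of_adj hr ((SimpleGraph.mem_edgeSet _).1 he)
    change profile r N (min (torusNorm (proj (r * i) p)) (torusNorm w)) = 1
    exact profile_eq_one hr hN (by omega)

end Torus

end ERRWGraph

open ERRWGraph in
/-- Lemma 8.1: for `r ≥ 130` and `0 < a < (r-129)/256` there are `l₀ ∈ ℕ` and `ξ > 0`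
such that for all `ℓ ∈ L_r` with `|ℓ|_∞ ≥ l₀` and all `i ≥ i₀(ℓ)` there is a function
`φ : E_r^{(i)} → [0,1]` satisfying Assumption 2.3 (for `G_r^{(i)}` with constant weights
`a`, vertices `0̄`, `ℓ̄` and reference edge `e₀ = {0̄,(1,0)}`) such that
`S_φ ≤ 1/(32(1+ξ) log(|ℓ|_∞/r))`. -/
theorem deformation_function_exists (r : ℕ) (hr : 130 ≤ r) (a : ℝ) (ha : 0 < a)
    (ha' : a < ((r : ℝ) - 129) / 256) :
    ∃ (l₀ : ℕ) (ξ : ℝ), 0 < ξ ∧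
      ∀ ℓ : ℤ × ℤ, ℓ ∈ LrZ r → (l₀ : ℤ) ≤ linf ℓ →
        ∀ (i : ℕ) [NeZero (r * i)], i0cond r ℓ i →
          ∀ e₀ : (Gper r i).edgeSet,
            (e₀ : Sym2 (ZMod (r * i) × ZMod (r * i))) =
              s(proj (r * i) (0, 0), proj (r * i) (1, 0)) →
            ∃ φ : Sym2 (ZMod (r * i) × ZMod (r * i)) → ℝ,
              Assumption23 (Gper r i) (fun _ => a) φ (proj (r * i) (0, 0))
                (proj (r * i) ℓ) e₀ ∧
              Sphi (Gper r i) (fun _ => a) φ ≤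
                1 / (32 * (1 + ξ) * Real.log ((linf ℓ : ℝ) / (r : ℝ))) := by
  have hr1 : (0 : ℝ) < r - 1 := sub_pos.2 (by exact_mod_cast (by omega : 1 < r))
  refine ⟨2 * r, (r - 1) / (128 * (2 * a + 1)) - 1, ?_, fun ℓ hℓ hl i _ hi e₀ he₀ => ?_⟩
  · rw [sub_pos, lt_div_iff₀ (by positivity)]
    linarith
  obtain ⟨N, hN⟩ := exists_linf_eq_mul hℓ
  have hN2 : 2 ≤ N := by
    rw [hN] at hl
    have : (r : ℤ) * 2 ≤ r * N := by push_cast at hl; linarith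
    exact_mod_cast le_of_mul_le_mul_left this (by omega)
  have hnorm : torusNorm (proj (r * i) ℓ) = r * N := by
    have := torusNorm_proj hℓ hi
    rw [hN] at this
    exact_mod_cast this
  refine ⟨deformation r N (r * i),
    assumption23_deformation (by omega) (by omega) a hℓ hnorm e₀ (by simp [he₀]), ?_⟩
  have hlog : 0 < Real.log N := Real.log_pos (by exact_mod_cast hN2)
  have hr0 : (r : ℝ) ≠ 0 := by
    have : r ≠ 0 := by omega
    exact_mod_cast this
  refine (Sphi_deformation_le (by omega) hN2 ha.le).trans_eq ?_
  rw [hN]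
  push_cast
  rw [mul_div_cancel_left₀ _ hr0, add_sub_cancel]
  have hr1' := hr1.ne'
  field_simp
  norm_num
end
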